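/- For every t with 1 ≤ t ≤ m−1: p^t(x) = 0 for all x ∈ A^t, and |A^t| = 2^{2^{m−t}(2^t−1)−t}. -/

import Mathlib

open Finset Pointwise

abbrev Word (n : ℕ) := Fin n → ZMod 2

def FEv (n : ℕ) : Set (Word n) := {x | Even (hammingNorm x)}

def FOd (n : ℕ) : Set (Word n) := {x | ¬ Even (hammingNorm x)}

def nbr {n : ℕ} (S : Set (Word n)) : Set (Word n) := {y | ∃ x ∈ S, hammingDist y x = 1}

def theta {n : ℕ} (G : Set (Word n)) : Set (Word n) :=
  {x | Even (hammingNorm x) ∧ nbr {x} ⊆ nbr G}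

def ExtPerfect {n : ℕ} (C : Set (Word n)) : Prop :=
  C ⊆ FEv n ∧ (∀ x ∈ C, ∀ y ∈ C, x ≠ y → Disjoint (nbr {x}) (nbr {y})) ∧ nbr C = FOd n

def IsIsometry {n : ℕ} (g : Word n → Word n) : Prop :=
  Function.Bijective g ∧ ∀ x y, hammingDist (g x) (g y) = hammingDist x y

def embWord (m t : ℕ) (v : Word (2 ^ (m - t))) : Word (2 ^ m) := fun i =>
  if h : (i : ℕ) < 2 ^ (m - t) then v ⟨i, h⟩
  else if h2 : (i : ℕ) < 2 * 2 ^ (m - t) then v ⟨(i : ℕ) - 2 ^ (m - t), by omega⟩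
  else 0

def Vt (m t : ℕ) : Set (Word (2 ^ m)) :=
  {x | ∃ v : Word (2 ^ (m - t)), Even (hammingNorm v) ∧ x = embWord m t v}

def At (m : ℕ) : ℕ → Set (Word (2 ^ m))
  | 0 => {0}
  | 1 => Vt m 1
  | t + 2 => Vt m (t + 2) + At m (t + 1)

def IsComp (m t : ℕ) (G : Set (Word (2 ^ m))) : Prop :=
  G ⊆ FEv (2 ^ m) ∧ G.ncard = (At m t).ncard ∧ nbr G = nbr (At m t)

def IsMuComp (m t : ℕ) (μ : Word (2 ^ m)) (M : Set (Word (2 ^ m))) : Prop :=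
  (∀ i : Fin (2 ^ m), 2 ^ (m - t) ≤ (i : ℕ) → μ i = 0) ∧
  ∃ G, IsComp m t G ∧ M = (fun x => μ + x) '' G

def arrEntry (m t : ℕ) (x : Word (2 ^ m)) (i : Fin (2 ^ t)) (j : Fin (2 ^ (m - t))) : ZMod 2 :=
  x ⟨((i : ℕ) * 2 ^ (m - t) + (j : ℕ)) % 2 ^ m, Nat.mod_lt _ (Nat.two_pow_pos m)⟩

def pchk (m t : ℕ) (x : Word (2 ^ m)) : Word (2 ^ (m - t)) :=
  fun j => ∑ i : Fin (2 ^ t), arrEntry m t x i j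

def Bt (m : ℕ) : ℕ → Set (Word (2 ^ m))
  | 0 => Vt m 1
  | 1 => Vt m 1
  | t + 2 => Vt m (t + 2) + theta (At m (t + 1))

/-- Periodic extension of a word of length `2 ^ m` to all natural indices. -/
def perExt {m : ℕ} (x : Word (2 ^ m)) (k : ℕ) : ZMod 2 :=
  x ⟨k % 2 ^ m, Nat.mod_lt _ (Nat.two_pow_pos m)⟩

lemma pchk_eq_sum_range (m t : ℕ) (x : Word (2 ^ m)) (j : Fin (2 ^ (m - t))) :
    pchk m t x j = ∑ i ∈ range (2 ^ t), perExt x (i * 2 ^ (m - t) + j) :=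
  (Finset.sum_range (fun i => perExt x (i * 2 ^ (m - t) + j))).symm

lemma pchk_add (m t : ℕ) (x y : Word (2 ^ m)) :
    pchk m t (x + y) = pchk m t x + pchk m t y := by
  funext j
  simp [pchk, arrEntry, Finset.sum_add_distrib]

lemma pchk_zero (m t : ℕ) : pchk m t 0 = 0 := by
  funext j
  simp [pchk, arrEntry]

lemma sum_range_two_mul {M : Type*} [AddCommMonoid M] (g : ℕ → M) (n : ℕ) :
    ∑ i ∈ range (2 * n), g i = ∑ i ∈ range n, g (2 * i) + ∑ i ∈ range n, g (2 * i + 1) := by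
  induction n with
  | zero => simp
  | succ n ih =>
    rw [show 2 * (n + 1) = 2 * n + 1 + 1 by ring, sum_range_succ, sum_range_succ, ih,
      sum_range_succ, sum_range_succ]
    abel

lemma two_pow_sub_eq {m t : ℕ} (h : t + 1 ≤ m) : 2 ^ (m - t) = 2 * 2 ^ (m - (t + 1)) := by
  rw [← pow_succ']
  congr 1
  omega

/-- A generalized parity check is obtained from the preceding one by adding its two halves. -/
lemma pchk_succ_eq_zero {m t : ℕ} (h : t + 1 ≤ m) {x : Word (2 ^ m)} (hx : pchk m t x = 0) :
    pchk m (t + 1) x = 0 := by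
  have hL := two_pow_sub_eq h
  funext j
  have hj := j.isLt
  have h0 := congrFun hx ⟨j, by omega⟩
  have h1 := congrFun hx ⟨2 ^ (m - (t + 1)) + j, by omega⟩
  rw [pchk_eq_sum_range] at h0 h1 ⊢
  rw [pow_succ', sum_range_two_mul]
  simp only [Pi.zero_apply] at h0 h1 ⊢
  rw [← add_zero (0 : ZMod 2)]
  nth_rewrite 1 [← h0]
  rw [← h1, hL]
  congr 1 <;> refine sum_congr rfl fun i _ => congrArg _ ?_ <;> ring

lemma perExt_embWord {m t k : ℕ} (v : Word (2 ^ (m - t))) (hk : k < 2 ^ m) :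
    perExt (embWord m t v) k = embWord m t v ⟨k, hk⟩ := by
  unfold perExt
  congr 2
  exact Nat.mod_eq_of_lt hk

lemma mul_add_lt_two_pow {m t i j : ℕ} (h : t ≤ m) (hi : i < 2 ^ t) (hj : j < 2 ^ (m - t)) :
    i * 2 ^ (m - t) + j < 2 ^ m := by
  have hm : 2 ^ m = 2 ^ t * 2 ^ (m - t) := by rw [← pow_add]; congr 1; omega
  rw [hm]
  nlinarith

lemma pchk_embWord {m t : ℕ} (h : t + 1 ≤ m) (v : Word (2 ^ (m - (t + 1)))) :
    pchk m (t + 1) (embWord m (t + 1) v) = 0 := by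
  funext j
  have hj := j.isLt
  rw [pchk_eq_sum_range, ← Finset.sum_subset (s₁ := range 2)]
  · have hb (i : ℕ) (hi : i < 2) :
        perExt (embWord m (t + 1) v) (i * 2 ^ (m - (t + 1)) + j) = v j := by
      have hi' : i < 2 ^ (t + 1) := hi.trans_le (Nat.le_self_pow (by omega) 2)
      rw [perExt_embWord v (mul_add_lt_two_pow h hi' hj)]
      interval_cases i
      · simp [embWord]
      · have : 2 ^ (m - (t + 1)) + (j : ℕ) < 2 * 2 ^ (m - (t + 1)) := by omega
        simp [embWord, this]
    simp only [sum_range_succ, range_zero, sum_empty]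
    rw [hb 0 (by omega), hb 1 (by omega), zero_add, CharTwo.add_self_eq_zero, Pi.zero_apply]
  · exact range_subset_range.2 (Nat.le_self_pow (by omega) 2)
  · intro i hi hi2
    rw [mem_range] at hi hi2
    rw [perExt_embWord v (mul_add_lt_two_pow h hi hj)]
    have : 2 * 2 ^ (m - (t + 1)) ≤ i * 2 ^ (m - (t + 1)) := Nat.mul_le_mul_right _ (by omega)
    unfold embWord
    rw [dif_neg (by dsimp only; omega), dif_neg (by dsimp only; omega)]

/-- The parity check one level up recovers the word that was embedded. -/
lemma pchk_embWord_succ {m t : ℕ} (h : t + 1 ≤ m) (v : Word (2 ^ (m - (t + 1))))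
    (j : Fin (2 ^ (m - (t + 1)))) (hj : (j : ℕ) < 2 ^ (m - t)) :
    pchk m t (embWord m (t + 1) v) ⟨j, hj⟩ = v j := by
  have hL := two_pow_sub_eq h
  rw [pchk_eq_sum_range, Finset.sum_eq_single 0]
  · rw [perExt_embWord v (mul_add_lt_two_pow (by omega) (by positivity) hj)]
    simp [embWord]
  · intro i hi hi0
    rw [mem_range] at hi
    rw [perExt_embWord v (mul_add_lt_two_pow (by omega) hi hj)]
    have : 1 * 2 ^ (m - t) ≤ i * 2 ^ (m - t) := Nat.mul_le_mul_right _ (by omega)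
    unfold embWord
    rw [dif_neg (by dsimp only; omega), dif_neg (by dsimp only; omega)]
  · simp

lemma even_hammingNorm_iff {n : ℕ} (x : Word n) : Even (hammingNorm x) ↔ ∑ i, x i = 0 := by
  have h (a : ZMod 2) : a = if a ≠ 0 then 1 else 0 := by revert a; decide
  rw [sum_congr rfl fun i _ => h (x i), sum_boole, ZMod.natCast_eq_zero_iff_even]
  rfl

lemma ncard_FEv_succ (n : ℕ) : (FEv (n + 1)).ncard = 2 ^ n := by
  have himg : FEv (n + 1) = Set.range fun w : Word n => (Fin.cons (∑ i, w i) w : Word (n + 1)) := by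
    ext x
    simp only [FEv, Set.mem_ofPred_eq, even_hammingNorm_iff, Fin.sum_univ_succ, Set.mem_range]
    constructor
    · intro hx
      refine ⟨Fin.tail x, ?_⟩
      rw [← Fin.cons_self_tail x]
      congr 1
      exact (CharTwo.add_eq_zero.1 hx).symm
    · rintro ⟨w, rfl⟩
      simp [CharTwo.add_self_eq_zero]
  have hinj : Function.Injective fun w : Word n => (Fin.cons (∑ i, w i) w : Word (n + 1)) :=
    fun _ _ hab => (Fin.cons_inj.1 hab).2
  rw [himg, ← Set.image_univ, Set.ncard_image_of_injective _ hinj, Set.ncard_univ,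
    Nat.card_eq_fintype_card]
  simp [ZMod.card]

lemma ncard_FEv {n : ℕ} (hn : 0 < n) : (FEv n).ncard = 2 ^ (n - 1) := by
  obtain ⟨k, rfl⟩ := Nat.exists_eq_succ_of_ne_zero hn.ne'
  exact ncard_FEv_succ k

lemma At_succ (m t : ℕ) : At m (t + 1) = Vt m (t + 1) + At m t := by
  cases t with
  | zero => simp [At]
  | succ t => rfl

lemma pchk_eq_zero_of_mem_At {m t : ℕ} (h : t ≤ m) {x : Word (2 ^ m)} (hx : x ∈ At m t) :
    pchk m t x = 0 := by
  induction t generalizing x with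
  | zero =>
    rw [show x = 0 from hx, pchk_zero]
  | succ t ih =>
    rw [At_succ] at hx
    obtain ⟨_, ⟨v, -, rfl⟩, y, hy, rfl⟩ := hx
    dsimp only
    rw [pchk_add, pchk_embWord h, pchk_succ_eq_zero h (ih (by omega) hy), add_zero]

lemma At_succ_eq_image (m t : ℕ) :
    At m (t + 1) =
      (fun p : Word (2 ^ (m - (t + 1))) × Word (2 ^ m) => embWord m (t + 1) p.1 + p.2) ''
        (FEv (2 ^ (m - (t + 1))) ×ˢ At m t) := by
  rw [At_succ]
  ext x
  constructor
  · rintro ⟨_, ⟨v, hv, rfl⟩, y, hy, rfl⟩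
    exact ⟨(v, y), ⟨hv, hy⟩, rfl⟩
  · rintro ⟨⟨v, y⟩, ⟨hv, hy⟩, rfl⟩
    exact ⟨_, ⟨v, hv, rfl⟩, y, hy, rfl⟩

lemma injOn_embWord_add {m t : ℕ} (h : t + 1 ≤ m) :
    Set.InjOn
      (fun p : Word (2 ^ (m - (t + 1))) × Word (2 ^ m) => embWord m (t + 1) p.1 + p.2)
      (FEv (2 ^ (m - (t + 1))) ×ˢ At m t) := by
  rintro ⟨v, x⟩ ⟨-, hx⟩ ⟨w, y⟩ ⟨-, hy⟩ hvw
  dsimp only at hx hy hvw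
  have hp := congrArg (pchk m t) hvw
  rw [pchk_add, pchk_add, pchk_eq_zero_of_mem_At (by omega) hx,
    pchk_eq_zero_of_mem_At (by omega) hy, add_zero, add_zero] at hp
  have hL := two_pow_sub_eq h
  obtain rfl : v = w := by
    funext j
    have hj : (j : ℕ) < 2 ^ (m - t) := by omega
    rw [← pchk_embWord_succ h v j hj, hp, pchk_embWord_succ h w j hj]
  rw [add_left_cancel hvw]

lemma ncard_At {m t : ℕ} (h : t ≤ m) :
    (At m t).ncard = 2 ^ (2 ^ (m - t) * (2 ^ t - 1) - t) := by
  induction t with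
  | zero => simp [At]
  | succ t ih =>
    rw [At_succ_eq_image, (injOn_embWord_add h).ncard_image, Set.ncard_prod,
      ncard_FEv (by positivity), ih (by omega), ← pow_add, two_pow_sub_eq h]
    congr 1
    have hL : 0 < 2 ^ (m - (t + 1)) := by positivity
    have hT : t < 2 ^ t := Nat.lt_two_pow_self
    rw [pow_succ 2 t]
    generalize 2 ^ (m - (t + 1)) = L at hL
    obtain ⟨k, hk⟩ : ∃ k, 2 ^ t = k + 1 := ⟨2 ^ t - 1, by omega⟩
    rw [hk] at hT ⊢
    have hle : k ≤ L * k := Nat.le_mul_of_pos_left k hL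
    rw [show (k + 1) * 2 - 1 = 2 * k + 1 by omega, Nat.add_sub_cancel,
      show L * (2 * k + 1) = 2 * (L * k) + L by ring, show 2 * L * k = 2 * (L * k) by ring]
    omega

/-- for 1 ≤ t ≤ m-1, p^t vanishes on A^t and |A^t| = 2^{2^{m-t}(2^t-1)-t}. -/
theorem stmt_5 (m t : ℕ) (hm : 4 ≤ m) (ht : 1 ≤ t) (ht' : t ≤ m - 1) :
    (∀ x ∈ At m t, pchk m t x = 0) ∧
    (At m t).ncard = 2 ^ (2 ^ (m - t) * (2 ^ t - 1) - t) := by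
  exact ⟨fun x hx => pchk_eq_zero_of_mem_At (by omega) hx, ncard_At (by omega)⟩
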